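/- arXiv:1703.05023 — 11 statements merged into one kernel-verified Lean document; each statement's English description precedes it below -/
import Mathlib

section
/- There exists a packing colouring of the two-way infinite path using only the colours 5 through 15; moreover it can be chosen periodic with period 36. Precisely, there exists a function c : ℤ → ℕ with c(m) ∈ {5,6,...,15} for all m, with c(m + 36) = c(m) for all m, and such that for all m ≠ n with c(m) = c(n) one has |m − n| > c(m). -/
/-- One period of a packing colouring of `ℤ` with the colours 5 through 15. -/
def packingPattern : ZMod 36 → ℕ :=
  ![5, 6, 10, 7, 11, 8, 5, 15, 6, 9, 14, 7, 5, 10, 8, 6, 11, 13,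
    5, 7, 9, 12, 6, 8, 5, 10, 15, 7, 11, 6, 5, 14, 8, 9, 13, 12]

theorem packingPattern_mem_Icc : ∀ x : ZMod 36, packingPattern x ∈ Finset.Icc 5 15 := by
  decide

theorem packingPattern_add_ne :
    ∀ x : ZMod 36, ∀ d < 16, 0 < d → d ≤ packingPattern x →
      packingPattern (x + (d : ℕ)) ≠ packingPattern x := by
  decide +kernel

theorem packingPattern_lt_sub_of_lt {m n : ℤ} (hmn : m < n)
    (h : packingPattern m = packingPattern n) : (packingPattern m : ℤ) < n - m := by
  by_contra! hle
  obtain ⟨d, hd⟩ := Int.eq_ofNat_of_zero_le (sub_nonneg.2 hmn.le)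
  have hub := (Finset.mem_Icc.1 (packingPattern_mem_Icc m)).2
  refine packingPattern_add_ne m d (by omega) (by omega) (by omega) ?_
  rw [h, show n = m + (d : ℤ) by omega]
  push_cast
  rfl

/-- There exists a packing colouring of the two-way infinite path `P∞` (vertex set `ℤ`,
distance `|m − n|`) using only the colours 5 through 15, which is periodic with period 36. -/
theorem packing_colouring_Z_colours_5_to_15_periodic_36 :
    ∃ c : ℤ → ℕ,
      (∀ m : ℤ, c m ∈ Finset.Icc 5 15) ∧
      (∀ m : ℤ, c (m + 36) = c m) ∧
      (∀ m n : ℤ, m ≠ n → c m = c n → (c m : ℤ) < |m - n|) := by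
  refine ⟨fun m => packingPattern m, fun m => packingPattern_mem_Icc m, fun m => ?_,
    fun m n hne h => ?_⟩
  · have h36 : ((m + 36 : ℤ) : ZMod 36) = m := by
      push_cast
      rw [show (36 : ZMod 36) = 0 by decide, add_zero]
    simp only [h36]
  · rcases hne.lt_or_gt with hlt | hgt
    · rw [abs_sub_comm, abs_of_pos (sub_pos.2 hlt)]
      exact packingPattern_lt_sub_of_lt hlt h
    · rw [abs_of_pos (sub_pos.2 hgt), h]
      exact packingPattern_lt_sub_of_lt hgt h.symm
end

section
/- There exists a packing colouring of the one-way infinite path (vertex set ℕ, with n adjacent to n+1) using only colours 5 through 15, such that in addition the first vertex 0 is at distance at least ⌈(i − 5)/2⌉ from every vertex of colour i. Precisely, there is c : ℕ → ℕ with c(n) ∈ {5,...,15} for all n, such that for all m ≠ n with c(m) = c(n) one has |m − n| > c(m), and such that for every n, n ≥ ⌈(c(n) − 5)/2⌉. -/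
/-- One period of a periodic packing colouring of the path by the colours 5 through 15. -/
def periodColours : Fin 36 → ℕ :=
  ![5, 6, 7, 10, 12, 15, 5, 8, 6, 9, 7, 11, 5, 13, 10, 6, 8, 14,
    5, 9, 7, 15, 6, 11, 5, 8, 12, 10, 7, 6, 5, 13, 14, 9, 8, 11]

theorem periodColours_mem_Icc (a : Fin 36) : periodColours a ∈ Finset.Icc 5 15 := by
  revert a
  decide

theorem periodColours_separated (a : Fin 36) (d : Fin 16) (hd : d ≠ 0)
    (h : periodColours a = periodColours (Fin.ofNat 36 (a + d))) :
    periodColours a < d := by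
  revert a d
  decide +kernel

theorem periodColours_le (a : Fin 36) : periodColours a ≤ 2 * a + 5 := by
  revert a
  decide

/-- The periodic colouring of `ℕ` with period `periodColours`. -/
def periodicColouring (n : ℕ) : ℕ := periodColours (Fin.ofNat 36 n)

theorem periodicColouring_mem_Icc (n : ℕ) : periodicColouring n ∈ Finset.Icc 5 15 :=
  periodColours_mem_Icc _

theorem periodicColouring_add_lt {m d : ℕ} (hd : 0 < d)
    (h : periodicColouring m = periodicColouring (m + d)) : periodicColouring m < d := by
  rcases Nat.lt_or_ge d 16 with hlt | hge
  · refine periodColours_separated (Fin.ofNat 36 m) ⟨d, hlt⟩ (by simp [Fin.ext_iff]; omega) ?_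
    have key : Fin.ofNat 36 ((Fin.ofNat 36 m : ℕ) + d) = Fin.ofNat 36 (m + d) := by
      simp [Fin.ext_iff]
    exact h.trans (congrArg periodColours key.symm)
  · have := (Finset.mem_Icc.mp (periodicColouring_mem_Icc m)).2
    omega

theorem periodicColouring_le (n : ℕ) : periodicColouring n ≤ 2 * n + 5 := by
  have h : periodicColouring n ≤ 2 * (n % 36) + 5 := periodColours_le (Fin.ofNat 36 n)
  have := Nat.mod_le n 36
  omega

/-- There exists a packing colouring of the one-way infinite path `P⁺∞` (vertex set `ℕ`,
distance `|m − n|`) using only colours 5 through 15, such that moreover every vertex of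
colour `i` is at distance at least `⌈(i − 5)/2⌉` from the first vertex `0`. -/
theorem packing_colouring_N_colours_5_to_15_far_from_origin :
    ∃ c : ℕ → ℕ,
      (∀ n : ℕ, c n ∈ Finset.Icc 5 15) ∧
      (∀ m n : ℕ, m ≠ n → c m = c n → ((c m : ℤ) < |(m : ℤ) - (n : ℤ)|)) ∧
      (∀ n : ℕ, ((c n : ℤ) - 5 + 1) / 2 ≤ (n : ℤ)) := by
  refine ⟨periodicColouring, periodicColouring_mem_Icc, fun m n hmn h => ?_, fun n => ?_⟩
  · rcases Nat.lt_or_gt_of_ne hmn with hlt | hlt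
    · obtain ⟨d, rfl⟩ := Nat.exists_eq_add_of_lt hlt
      have := periodicColouring_add_lt (m := m) (d := d + 1) (by omega) h
      rw [lt_abs]
      omega
    · obtain ⟨d, rfl⟩ := Nat.exists_eq_add_of_lt hlt
      have := periodicColouring_add_lt (m := n) (d := d + 1) (by omega) h.symm
      rw [lt_abs]
      omega
  · have := periodicColouring_le n
    omega
end

section
/- For every positive integer k and every integer n > 2, the cycle C_n admits a packing colouring using only colours from the set {k, k+1, ..., 6k+4}. Precisely, there exists c : ZMod n → ℕ with k ≤ c(v) ≤ 6k+4 for all v, such that any two distinct vertices u, v of C_n with c(u) = c(v) satisfy d(u,v) > c(u), where d is the graph distance in the cycle C_n (so d(i,j) = min(|i − j|, n − |i − j|) computed on representatives in {0,...,n−1}). -/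
/-- Graph distance in the cycle `C_n` with vertex set `ZMod n`: the distance between `u`
and `v` is `min (|u - v|) (n - |u - v|)` computed on representatives in `{0, …, n−1}`. -/
def cycleDist (n : ℕ) (u v : ZMod n) : ℕ :=
  min ((u.val : ℤ) - (v.val : ℤ)).natAbs (n - ((u.val : ℤ) - (v.val : ℤ)).natAbs)

/-- A colouring of the vertices `0, …, m - 1` of the cycle `C_m` by `1, 2, 3, 4`: the pattern
`1, 2, 1, 3` is repeated, and the last vertex gets colour `4` unless `4 ∣ m`. The extra
index `m` gets the value `5`. -/
def cyclePackingPattern (m i : ℕ) : ℕ :=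
  if i = m then 5
  else if i + 1 = m ∧ m % 4 ≠ 0 then 4
  else if i % 2 = 0 then 1
  else if i % 4 = 1 then 2
  else 3

theorem one_le_cyclePackingPattern (m i : ℕ) : 1 ≤ cyclePackingPattern m i := by
  unfold cyclePackingPattern
  split_ifs <;> omega

theorem cyclePackingPattern_le_four {m i : ℕ} (h : i ≠ m) : cyclePackingPattern m i ≤ 4 := by
  unfold cyclePackingPattern
  split_ifs <;> omega

theorem cyclePackingPattern_self (m : ℕ) : cyclePackingPattern m m = 5 := by
  simp [cyclePackingPattern]

/-- Two indices with the same pattern value are far apart in `C_m`, in both directions. -/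
theorem cyclePackingPattern_separated {m i j : ℕ} (hij : i < j) (hj : j ≤ m)
    (h : cyclePackingPattern m i = cyclePackingPattern m j) :
    cyclePackingPattern m i + 1 ≤ j - i ∧ cyclePackingPattern m i + 1 + (j - i) ≤ m := by
  unfold cyclePackingPattern at *
  split_ifs at * <;> omega

/-- The colouring of `0, …, n - 1` obtained by arranging the vertices in rows of length `N` and
colouring every column by the pattern, with a separate set of colours for each column. -/
def rowColouring (N n x : ℕ) : ℕ :=
  N * cyclePackingPattern (n / N) (x / N) + x % N

theorem rowColouring_bounds {N n x : ℕ} (hN : 0 < N) (hx : x < n) :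
    N ≤ rowColouring N n x ∧ rowColouring N n x + 2 ≤ 6 * N := by
  have hmod := Nat.mod_lt x hN
  have h1 := one_le_cyclePackingPattern (n / N) (x / N)
  unfold rowColouring
  refine ⟨(Nat.le_mul_of_pos_right N h1).trans (Nat.le_add_right _ _), ?_⟩
  by_cases h : x / N = n / N
  · have hx' := Nat.div_add_mod x N
    have hn' := Nat.div_add_mod n N
    have hn_mod := Nat.mod_lt n hN
    rw [h] at hx' ⊢
    rw [cyclePackingPattern_self]
    omega
  · have h4 := Nat.mul_le_mul_left N (cyclePackingPattern_le_four h)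
    omega

theorem rowColouring_separated {N n x y : ℕ} (hN : 0 < N) (hxy : x < y) (hy : y < n)
    (h : rowColouring N n x = rowColouring N n y) :
    rowColouring N n x < y - x ∧ rowColouring N n x < n - (y - x) := by
  have hmod : x % N = y % N := by
    have := congrArg (· % N) h
    simpa [rowColouring, Nat.mul_add_mod] using this
  have hpat : cyclePackingPattern (n / N) (x / N) = cyclePackingPattern (n / N) (y / N) := by
    unfold rowColouring at h
    rw [hmod] at h
    exact Nat.eq_of_mul_eq_mul_left hN (Nat.add_right_cancel h)
  have hx' := Nat.div_add_mod x N
  have hy' := Nat.div_add_mod y N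
  have hn' := Nat.div_add_mod n N
  have hlt : x / N < y / N := by
    refine lt_of_le_of_ne (Nat.div_le_div_right hxy.le) fun he => ?_
    rw [he, hmod] at hx'
    omega
  obtain ⟨h1, h2⟩ := cyclePackingPattern_separated hlt (Nat.div_le_div_right hy.le) hpat
  have hx_mod := Nat.mod_lt x hN
  have hdiff : y - x = N * (y / N - x / N) := by
    rw [Nat.mul_sub]
    omega
  have h1' := Nat.mul_le_mul_left N h1
  have h2' := Nat.mul_le_mul_left N h2
  simp only [Nat.mul_add, Nat.mul_one] at h1' h2'
  unfold rowColouring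
  omega

/-- For every positive integer `k` and every `n > 2`, the cycle `C_n` admits a packing
colouring using only colours from `{k, k+1, …, 6k+4}`. -/
theorem packing_colouring_cycle_colours_k_to_6k_add_4 (k : ℕ) (hk : 0 < k)
    (n : ℕ) (hn : 2 < n) :
    ∃ c : ZMod n → ℕ,
      (∀ v : ZMod n, k ≤ c v ∧ c v ≤ 6 * k + 4) ∧
      (∀ u v : ZMod n, u ≠ v → c u = c v → c u < cycleDist n u v) := by
  have : NeZero n := ⟨by omega⟩
  refine ⟨fun v => rowColouring (k + 1) n v.val, fun v => ?_, fun u v huv h => ?_⟩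
  · have := rowColouring_bounds k.succ_pos v.val_lt
    dsimp only [Nat.succ_eq_add_one] at this ⊢
    omega
  · dsimp only at h ⊢
    have hne : u.val ≠ v.val := fun he => huv (ZMod.val_injective n he)
    unfold cycleDist
    rcases lt_or_gt_of_ne hne with hlt | hlt
    · have := rowColouring_separated k.succ_pos hlt v.val_lt h
      dsimp only [Nat.succ_eq_add_one] at this
      omega
    · have := rowColouring_separated k.succ_pos hlt u.val_lt h.symm
      dsimp only [Nat.succ_eq_add_one] at this
      omega
end

section
/- Let G be a (simple, connected on the relevant vertices) graph and let A ⊆ V(G) be a cycle-distance-preserved set, i.e. A = {v_0, v_1, ..., v_{s−1}} (s = |A|) with d_G(v_j, v_{j'}) ≥ min(|j − j'|, s − |j − j'|) for all 0 ≤ j < j' ≤ s−1. Then for every positive integer k the vertices of A can be packing-coloured with colours from {k, k+1, ..., 6k+4}: there exists c : A → ℕ with k ≤ c(v) ≤ 6k+4 for all v ∈ A, such that any two distinct u, v ∈ A with c(u) = c(v) satisfy d_G(u,v) > c(u). -/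
/-- For `s` positive and indices `j, j'` in `{0, …, s−1}`, the cyclic distance between
`j` and `j'` is `min (|j − j'|) (s − |j − j'|)`; it equals the graph distance between
`j` and `j'` in the cycle `C_s`. -/
def cyclicDist (s j j' : ℕ) : ℕ :=
  min ((j : ℤ) - (j' : ℤ)).natAbs (s - ((j : ℤ) - (j' : ℤ)).natAbs)

/-- The next threshold after `N` when a block of `⌈N / h⌉` consecutive colours is used up. -/
def nextThreshold (h N : ℕ) : ℕ := N + (N + h - 1) / h

lemma lt_nextThreshold {h N : ℕ} (hh : 0 < h) (hN : 0 < N) : N < nextThreshold h N := by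
  have : 0 < (N + h - 1) / h := Nat.div_pos (by omega) hh
  unfold nextThreshold
  omega

lemma nextThreshold_le_mul {h : ℕ} (hh : 0 < h) (N : ℕ) :
    nextThreshold h N ≤ (h + 1) * (nextThreshold h N - N) := by
  have h1 := Nat.div_add_mod (N + h - 1) h
  have h2 := Nat.mod_lt (N + h - 1) hh
  simp only [nextThreshold, Nat.add_sub_cancel_left, Nat.add_mul, Nat.one_mul]
  omega

/-- A strictly increasing sequence of thresholds `N 0 < N 1 < ⋯ < N g` whose successive gaps satisfy
`N (i + 1) ≤ g * (N (i + 1) - N i)` yields a packing colouring of the infinite path with the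
colours in `[N 0, N g)`: the residue class of `i` modulo `g` is coloured cyclically with
`[N i, N (i + 1))`. -/
lemma exists_path_packing_of_thresholds {g : ℕ} (hg : 0 < g) (N : ℕ → ℕ) (hN : StrictMono N)
    (hgap : ∀ i, N (i + 1) ≤ g * (N (i + 1) - N i)) :
    ∃ p : ℕ → ℕ, (∀ x, N 0 ≤ p x ∧ p x < N g) ∧ ∀ x y, x < y → p x = p y → p x < y - x := by
  set p : ℕ → ℕ := fun x => N (x % g) + (x / g) % (N (x % g + 1) - N (x % g)) with hp
  have lower (x : ℕ) : N (x % g) ≤ p x := Nat.le_add_right _ _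
  have upper (x : ℕ) : p x < N (x % g + 1) := by
    have h1 : N (x % g) < N (x % g + 1) := hN (Nat.lt_succ_self _)
    have h2 := Nat.mod_lt (x / g) (Nat.sub_pos_of_lt h1)
    simp only [hp]
    omega
  refine ⟨p, fun x => ⟨(hN.monotone (Nat.zero_le _)).trans (lower x),
    (upper x).trans_le (hN.monotone (Nat.mod_lt x hg))⟩, fun x y hxy hpxy => ?_⟩
  have hres : x % g = y % g := by
    have h1 : x % g < y % g + 1 :=
      hN.lt_iff_lt.1 ((lower x).trans_lt (hpxy ▸ upper y))
    have h2 : y % g < x % g + 1 :=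
      hN.lt_iff_lt.1 ((lower y).trans_lt (hpxy ▸ upper x))
    omega
  have hmod : x / g ≡ y / g [MOD N (x % g + 1) - N (x % g)] := by
    simp only [hp, ← hres] at hpxy
    exact Nat.add_left_cancel hpxy
  have hx := Nat.div_add_mod x g
  have hy := Nat.div_add_mod y g
  have hdiv : x / g < y / g := by
    by_contra! hle
    have := Nat.mul_le_mul_left g hle
    omega
  have hgapdiv : N (x % g + 1) - N (x % g) ≤ y / g - x / g :=
    Nat.le_of_dvd (Nat.sub_pos_of_lt hdiv) ((Nat.modEq_iff_dvd' hdiv.le).1 hmod)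
  calc p x < N (x % g + 1) := upper x
    _ ≤ g * (N (x % g + 1) - N (x % g)) := hgap _
    _ ≤ g * (y / g - x / g) := Nat.mul_le_mul_left g hgapdiv
    _ = y - x := by rw [Nat.mul_sub]; omega

lemma exists_iterate_nextThreshold_le {k : ℕ} (hk : 0 < k) :
    ∃ h, 0 < h ∧ (nextThreshold h)^[h + 1] k ≤ 3 * k + 3 := by
  obtain hlt | hge := lt_or_ge k 100
  · have small : ∀ k < 100, 0 < k →
        ∃ h < 20, 0 < h ∧ (nextThreshold h)^[h + 1] k ≤ 3 * k + 3 := by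
      decide +kernel
    obtain ⟨h, -, hh⟩ := small k hlt hk
    exact ⟨h, hh⟩
  · refine ⟨7, by norm_num, ?_⟩
    have step (i : ℕ) : 7 * (nextThreshold 7)^[i + 1] k ≤ 8 * (nextThreshold 7)^[i] k + 6 := by
      rw [Function.iterate_succ_apply', nextThreshold]
      omega
    have h0 := step 0
    have h1 := step 1
    have h2 := step 2
    have h3 := step 3
    have h4 := step 4
    have h5 := step 5
    have h6 := step 6
    have h7 := step 7
    rw [Function.iterate_zero_apply] at h0
    norm_num only at h0 h1 h2 h3 h4 h5 h6 h7 ⊢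
    omega

/-- The infinite path has a packing colouring with the colours `k, …, 3 * k + 2`. -/
lemma exists_path_packing {k : ℕ} (hk : 0 < k) :
    ∃ p : ℕ → ℕ, (∀ x, k ≤ p x ∧ p x ≤ 3 * k + 2) ∧
      ∀ x y, x < y → p x = p y → p x < y - x := by
  obtain ⟨h, hh, hle⟩ := exists_iterate_nextThreshold_le hk
  have hpos (i : ℕ) : 0 < (nextThreshold h)^[i] k := by
    induction i with
    | zero => exact hk
    | succ i ih =>
      rw [Function.iterate_succ_apply']
      exact ih.trans (lt_nextThreshold hh ih)
  obtain ⟨p, hp, hdist⟩ := exists_path_packing_of_thresholds (Nat.succ_pos h)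
    (fun i => (nextThreshold h)^[i] k)
    (strictMono_nat_of_lt_succ fun i => by
      simp only [Function.iterate_succ_apply']
      exact lt_nextThreshold hh (hpos i))
    (fun i => by
      simp only [Function.iterate_succ_apply']
      exact nextThreshold_le_mul hh _)
  refine ⟨p, fun x => ⟨(hp x).1, ?_⟩, hdist⟩
  have : p x < (nextThreshold h)^[h + 1] k := (hp x).2
  omega

/-- If `A = {v 0, …, v (s−1)}` is a cycle-distance-preserved set of vertices of a graph
`G` (i.e. `d_G(v j, v j') ≥` cyclic distance between `j` and `j'` for all `j ≠ j'`), then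
for every positive integer `k` the vertices of `A` can be packing-coloured with colours
from `{k, k+1, …, 6k+4}`. -/
theorem packing_colouring_cycle_distance_preserved_set {V : Type*} (G : SimpleGraph V)
    (s : ℕ) (v : Fin s → V) (hv : Function.Injective v)
    (hd : ∀ j j' : Fin s, j ≠ j' → cyclicDist s j.val j'.val ≤ G.dist (v j) (v j'))
    (k : ℕ) (hk : 0 < k) :
    ∃ c : Fin s → ℕ,
      (∀ j : Fin s, k ≤ c j ∧ c j ≤ 6 * k + 4) ∧
      (∀ j j' : Fin s, j ≠ j' → c j = c j' → c j < G.dist (v j) (v j')) := by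
  obtain ⟨p, hp, hdist⟩ := exists_path_packing hk
  have key : ∃ c : Fin s → ℕ, (∀ j, k ≤ c j ∧ c j ≤ 6 * k + 4) ∧
      ∀ j j' : Fin s, j < j' → c j = c j' → c j < cyclicDist s j j' := by
    refine ⟨fun j => if j.val < s - (3 * k + 2) then p j
      else 3 * k + 3 + (j.val - (s - (3 * k + 2))), fun j => ?_, fun j j' hlt hc => ?_⟩
    · have := hp j
      have := j.isLt
      dsimp only
      split_ifs <;> omega
    · have h1 := hp j
      have h2 := hp j'
      have h3 := hdist j j' hlt
      have h4 : j.val < j'.val := hlt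
      have h5 := j'.isLt
      simp only [cyclicDist] at hc ⊢
      split_ifs at hc ⊢ <;> omega
  obtain ⟨c, hrange, hc⟩ := key
  refine ⟨c, hrange, fun j j' hne heq => ?_⟩
  obtain hlt | hgt := lt_or_gt_of_ne hne
  · exact (hc j j' hlt heq).trans_le (hd j j' hne)
  · rw [heq, G.dist_comm]
    exact (hc j' j hgt heq.symm).trans_le (hd j' j hne.symm)
end

section
/- Let G be a graph, let r be a positive integer, and let A ⊆ V(G) be decomposable into r cycle-distance-preserved sets, i.e. A = A_1 ∪ A_2 ∪ ... ∪ A_r where each A_i is a cycle-distance-preserved set in G. Then for every positive integer k the vertices of A can be packing-coloured with colours from {k, k+1, ..., 6^r·(k+1) − 2}: there exists c : A → ℕ with k ≤ c(v) ≤ 6^r·(k+1) − 2 for all v ∈ A, such that any two distinct u, v ∈ A with c(u) = c(v) satisfy d_G(u,v) > c(u). -/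
/-- A set `B` of vertices of a graph `G` is cycle-distance-preserved if there is an
ordering `v 0, …, v (s−1)` of its vertices such that `d_G(v j, v j')` is at least the
cyclic distance between `j` and `j'` for all `j ≠ j'`. -/
def IsCycleDistancePreserved {V : Type*} (G : SimpleGraph V) (B : Set V) : Prop :=
  ∃ (s : ℕ) (v : Fin s → V), Function.Injective v ∧ Set.range v = B ∧
    ∀ j j' : Fin s, j ≠ j' → cyclicDist s j.val j'.val ≤ G.dist (v j) (v j')

/-- The spacing assigned to position `p` when the first `L` positions of a cyclic sequence follow
a pattern of period `4 * n`, and the remaining positions get pairwise distinct spacings. -/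
def patternSpacing (n L p : ℕ) : ℕ :=
  if p < L then
    if p % (4 * n) < 2 * n then n + p % (4 * n)
    else if p % (4 * n) < 3 * n then p % (4 * n) - n
    else p % (4 * n)
  else 4 * n + (p - L)

/-- The length of the periodic part of the pattern on a cycle of length `s`. -/
def patternLength (n s : ℕ) : ℕ :=
  4 * n * (s / (4 * n)) +
    if s % (4 * n) ≤ 2 * n then 0 else if s % (4 * n) ≤ 3 * n then n else 2 * n

theorem patternLength_le (n s : ℕ) : patternLength n s ≤ s := by
  have hs := Nat.div_add_mod s (4 * n)
  unfold patternLength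
  generalize 4 * n * (s / (4 * n)) = Q at *
  generalize s % (4 * n) = u at *
  split_ifs <;> omega

theorem le_patternSpacing {n L p : ℕ} : n ≤ patternSpacing n L p := by
  unfold patternSpacing
  split_ifs <;> omega

theorem patternSpacing_lt {n s p : ℕ} (hn : 0 < n) (hp : p < s) :
    patternSpacing n (patternLength n s) p < 6 * n := by
  have hs := Nat.div_add_mod s (4 * n)
  have hu := Nat.mod_lt s (show 0 < 4 * n by omega)
  have hx := Nat.mod_lt p (show 0 < 4 * n by omega)
  unfold patternSpacing patternLength
  generalize 4 * n * (s / (4 * n)) = Q at *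
  generalize s % (4 * n) = u at *
  generalize p % (4 * n) = x at *
  split_ifs <;> omega

theorem mul_eq_or_add_le_of_le {m a b : ℕ} (h : a ≤ b) : m * a = m * b ∨ m * a + m ≤ m * b := by
  rcases h.eq_or_lt with rfl | h
  · exact Or.inl rfl
  · exact Or.inr (by simpa [Nat.mul_succ] using Nat.mul_le_mul_left m h)

theorem patternSpacing_le {n s p p' : ℕ} (hn : 0 < n) (hlt : p < p') (hp' : p' < s)
    (h : patternSpacing n (patternLength n s) p = patternSpacing n (patternLength n s) p') :
    patternSpacing n (patternLength n s) p ≤ p' - p ∧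
      patternSpacing n (patternLength n s) p ≤ s - (p' - p) := by
  have hs := Nat.div_add_mod s (4 * n)
  have hu := Nat.mod_lt s (show 0 < 4 * n by omega)
  have hp := Nat.div_add_mod p (4 * n)
  have hx := Nat.mod_lt p (show 0 < 4 * n by omega)
  have hq := Nat.div_add_mod p' (4 * n)
  have hy := Nat.mod_lt p' (show 0 < 4 * n by omega)
  have h1 := mul_eq_or_add_le_of_le (m := 4 * n) (Nat.div_le_div_right (c := 4 * n) hlt.le)
  have h2 := mul_eq_or_add_le_of_le (m := 4 * n) (Nat.div_le_div_right (c := 4 * n) hp'.le)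
  unfold patternSpacing patternLength at *
  generalize 4 * n * (s / (4 * n)) = Q at *
  generalize s % (4 * n) = u at *
  generalize 4 * n * (p / (4 * n)) = P at *
  generalize p % (4 * n) = x at *
  generalize 4 * n * (p' / (4 * n)) = P' at *
  generalize p' % (4 * n) = y at *
  split_ifs at h ⊢ <;> omega

theorem cyclicDist_comm (s j j' : ℕ) : cyclicDist s j j' = cyclicDist s j' j := by
  unfold cyclicDist
  rw [show ((j : ℤ) - j').natAbs = ((j' : ℤ) - j).natAbs by omega]

theorem patternSpacing_le_cyclicDist {n s j j' : ℕ} (hn : 0 < n) (hj : j < s) (hj' : j' < s)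
    (hne : j ≠ j')
    (h : patternSpacing n (patternLength n s) j = patternSpacing n (patternLength n s) j') :
    patternSpacing n (patternLength n s) j ≤ cyclicDist s j j' := by
  wlog hlt : j < j' generalizing j j'
  · rw [h, cyclicDist_comm]
    exact this hj' hj hne.symm h.symm (by omega)
  have := patternSpacing_le hn hlt hj' h
  unfold cyclicDist
  rw [show ((j : ℤ) - j').natAbs = j' - j by omega]
  exact le_min this.1 this.2

/-- A cycle-distance-preserved set has a packing colouring with colours `n - 1, …, 6 * n - 2`. -/
theorem IsCycleDistancePreserved.exists_packing_colouring {V : Type*} {G : SimpleGraph V}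
    {B : Set V} (hB : IsCycleDistancePreserved G B) {n : ℕ} (hn : 0 < n) :
    ∃ c : V → ℕ, (∀ v ∈ B, n ≤ c v + 1 ∧ c v + 1 < 6 * n) ∧
      ∀ u ∈ B, ∀ v ∈ B, u ≠ v → c u = c v → c u < G.dist u v := by
  obtain ⟨s, v, hv, rfl, hd⟩ := hB
  have hext : ∀ j, Function.extend v
      (fun j : Fin s => patternSpacing n (patternLength n s) j - 1) 0 (v j) + 1 =
        patternSpacing n (patternLength n s) j := fun j => by
    have := le_patternSpacing (n := n) (L := patternLength n s) (p := j)
    rw [hv.extend_apply]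
    omega
  refine ⟨Function.extend v
    (fun j : Fin s => patternSpacing n (patternLength n s) j - 1) 0, ?_, ?_⟩
  · rintro _ ⟨j, rfl⟩
    rw [hext]
    exact ⟨le_patternSpacing, patternSpacing_lt hn j.2⟩
  · rintro _ ⟨j, rfl⟩ _ ⟨j', rfl⟩ hne hc
    have hjj : j ≠ j' := fun h => hne (congrArg v h)
    have h : patternSpacing n (patternLength n s) j = patternSpacing n (patternLength n s) j' := by
      rw [← hext, ← hext, hc]
    rw [← Nat.succ_le_iff, Nat.succ_eq_add_one, hext]
    exact (patternSpacing_le_cyclicDist hn j.2 j'.2 (Fin.val_ne_of_ne hjj) h).trans (hd j j' hjj)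

/-- If `A ⊆ V(G)` is decomposable into `r` cycle-distance-preserved sets, then for every
positive integer `k` the vertices of `A` can be packing-coloured with colours from
`{k, k+1, …, 6^r·(k+1) − 2}`. -/
theorem packing_colouring_decomposable_set {V : Type*} (G : SimpleGraph V)
    (r : ℕ) (hr : 0 < r) (A : Set V) (As : Fin r → Set V)
    (hA : A = ⋃ i, As i) (hAs : ∀ i, IsCycleDistancePreserved G (As i))
    (k : ℕ) (hk : 0 < k) :
    ∃ c : V → ℕ,
      (∀ v ∈ A, k ≤ c v ∧ c v ≤ 6 ^ r * (k + 1) - 2) ∧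
      (∀ u ∈ A, ∀ v ∈ A, u ≠ v → c u = c v → c u < G.dist u v) := by
  subst hA
  choose c hc hpack using fun i : Fin r =>
    (hAs i).exists_packing_colouring (n := 6 ^ (i : ℕ) * (k + 1)) (by positivity)
  have hlt : ∀ i j : Fin r, i < j → ∀ u ∈ As i, ∀ v ∈ As j, c i u < c j v := by
    intro i j hij u hu v hv
    have h1 := (hc i u hu).2
    have h2 := (hc j v hv).1
    have h3 : 6 ^ ((i : ℕ) + 1) * (k + 1) ≤ 6 ^ (j : ℕ) * (k + 1) :=
      Nat.mul_le_mul_right _ (Nat.pow_le_pow_right (by norm_num) hij)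
    rw [pow_succ'] at h3
    linarith
  have hidx : ∀ v, ∃ i : Fin r, v ∈ ⋃ i, As i → v ∈ As i := by
    intro v
    by_cases h : v ∈ ⋃ i, As i
    · obtain ⟨i, hi⟩ := Set.mem_iUnion.1 h
      exact ⟨i, fun _ => hi⟩
    · exact ⟨⟨0, hr⟩, fun h' => absurd h' h⟩
  choose idx hidx using hidx
  refine ⟨fun v => c (idx v) v, fun v hv => ?_, fun u hu v hv hne h => ?_⟩
  · obtain ⟨h1, h2⟩ := hc _ v (hidx v hv)
    have h3 : 6 ^ ((idx v : ℕ) + 1) * (k + 1) ≤ 6 ^ r * (k + 1) :=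
      Nat.mul_le_mul_right _ (Nat.pow_le_pow_right (by norm_num) (idx v).2)
    have h4 : 1 * (k + 1) ≤ 6 ^ (idx v : ℕ) * (k + 1) :=
      Nat.mul_le_mul_right _ (Nat.one_le_pow' _ 5)
    rw [pow_succ', mul_assoc] at h3
    dsimp only
    omega
  · have hidx_eq : idx u = idx v := by
      rcases lt_trichotomy (idx u) (idx v) with hij | hij | hij
      · exact absurd h (hlt _ _ hij u (hidx u hu) v (hidx v hv)).ne
      · exact hij
      · exact absurd h (hlt _ _ hij v (hidx v hv) u (hidx u hu)).ne'
    have hv' := hidx v hv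
    dsimp only at h ⊢
    rw [← hidx_eq] at h hv'
    exact hpack _ u (hidx u hu) v hv' hne h
end

section
/- Let G be a graph, let s be a positive integer, and let w_0, w_1, ..., w_{s−1} be vertices of G such that for all 0 ≤ j < j' ≤ s−1 one has d_G(w_j, w_{j'}) ≥ 2·min(|j − j'|, s − |j − j'|) + 1. Then these vertices can be packing-coloured with colours from the 19-element set {16, 17, ..., 28} ∪ {46, 47, ..., 51}: there exists c : {w_0, ..., w_{s−1}} → ℕ taking values in {16,...,28} ∪ {46,...,51} such that any two distinct vertices u, v among the w_j with c(u) = c(v) satisfy d_G(u,v) > c(u). -/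
/-- `l`, read cyclically, is a colour sequence with colours in `{16, …, 28} ∪ {46, …, 51}` in which
any two occurrences of a colour `k` are at cyclic distance at least `k / 2`. -/
def IsPackingCycle (l : List ℕ) : Prop :=
  (∀ k ∈ l, k ∈ Finset.Icc 16 28 ∪ Finset.Icc 46 51) ∧
    ∀ j < l.length, ∀ i < j, l.getD i 0 = l.getD j 0 →
      l.getD i 0 ≤ 2 * (j - i) ∧ l.getD i 0 ≤ 2 * (l.length - (j - i))

instance : DecidablePred IsPackingCycle := fun _ => instDecidableAnd

/-- Two packing cycles with a common prefix of length at least 25 can be spliced. -/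
theorem IsPackingCycle.splice {p x y : List ℕ} (hp : 25 ≤ p.length)
    (hx : x ≠ []) (hy : y ≠ []) (hpx : IsPackingCycle (p ++ x)) (hpy : IsPackingCycle (p ++ y)) :
    IsPackingCycle (p ++ (x ++ (p ++ y))) := by
  have hx' := List.length_pos_iff.2 hx
  have hy' := List.length_pos_iff.2 hy
  obtain ⟨hcx, hdx⟩ := hpx
  obtain ⟨hcy, hdy⟩ := hpy
  have hc : ∀ k ∈ p ++ (x ++ (p ++ y)), k ∈ Finset.Icc 16 28 ∪ Finset.Icc 46 51 := by
    intro k hk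
    rw [← List.append_assoc, List.mem_append] at hk
    exact hk.elim (hcx k) (hcy k)
  refine ⟨hc, ?_⟩
  rw [← List.append_assoc] at hc ⊢
  have hprefix : ∀ i < 25, (p ++ x).getD i 0 = (p ++ y).getD i 0 := by
    intro i hi
    rw [List.getD_append _ _ _ _ (by lia), List.getD_append _ _ _ _ (by lia)]
  have hlx : 25 < (p ++ x).length := by rw [List.length_append]; lia
  have hly : 25 < (p ++ y).length := by rw [List.length_append]; lia
  generalize p ++ x = a at *
  generalize p ++ y = b at *
  intro j hj i hij heq
  have hbound : (a ++ b).getD i 0 ≤ 51 := by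
    have hi : i < (a ++ b).length := hij.trans hj
    rw [List.getD_eq_getElem _ _ hi]
    have := hc _ (List.getElem_mem hi)
    simp only [Finset.mem_union, Finset.mem_Icc] at this
    lia
  rw [List.length_append] at hj ⊢
  rcases lt_or_ge j a.length with hja | hja
  · rw [List.getD_append _ _ _ _ (hij.trans hja)] at heq ⊢
    rw [List.getD_append _ _ _ _ hja] at heq
    have := hdx j hja i hij heq
    lia
  rw [List.getD_append_right _ _ _ j hja] at heq
  rcases lt_or_ge i a.length with hia | hia
  · rw [List.getD_append _ _ _ _ hia] at heq hbound ⊢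
    constructor
    · by_cases hj25 : j - a.length < 25
      · rw [← hprefix _ hj25] at heq
        rcases lt_trichotomy i (j - a.length) with h | h | h
        · have := hdx _ (by lia) i h heq
          lia
        · lia
        · have := hdx i hia _ h heq.symm
          lia
      · lia
    · by_cases hi25 : i < 25
      · rw [hprefix _ hi25] at heq hbound ⊢
        rcases lt_trichotomy i (j - a.length) with h | h | h
        · have := hdy _ (by lia) i h heq
          lia
        · lia
        · have := hdy i (by lia) _ h heq.symm
          lia
      · lia
  · rw [List.getD_append_right _ _ _ i hia] at heq ⊢
    have := hdy (j - a.length) (by lia) (i - a.length) (by lia) heq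
    lia

/-- The common prefix of the packing cycles of length at least 26. -/
def packingPrefix : List ℕ :=
  [16, 17, 18, 19, 20, 21, 22, 23, 16, 24, 17, 18, 25, 19, 20, 26, 16, 21, 22, 23, 27, 24,
    28, 46, 47]

/-- Continuations of `packingPrefix` to packing cycles of lengths 26 to 51. -/
def packingTails : List (List ℕ) :=
  [[25],
   [25, 48],
   [25, 48, 49],
   [25, 48, 49, 26],
   [25, 48, 49, 26, 50],
   [20, 25, 48, 26, 49, 50],
   [18, 20, 25, 26, 48, 49, 50],
   [16, 18, 20, 25, 26, 48, 49, 50],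
   [16, 17, 18, 20, 22, 25, 26, 48, 49],
   [16, 17, 18, 19, 20, 22, 25, 26, 48, 27],
   [16, 17, 18, 19, 20, 21, 22, 25, 24, 26, 27],
   [16, 17, 18, 19, 20, 21, 22, 23, 24, 25, 26, 27],
   [16, 17, 18, 19, 20, 21, 22, 23, 24, 25, 26, 27, 28],
   [16, 17, 18, 19, 20, 21, 22, 23, 24, 25, 26, 27, 28, 48],
   [16, 17, 18, 19, 20, 21, 22, 23, 24, 25, 26, 27, 28, 48, 49],
   [16, 17, 18, 19, 20, 21, 22, 23, 16, 24, 25, 26, 27, 28, 48, 49],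
   [16, 17, 18, 19, 20, 21, 22, 23, 16, 24, 25, 26, 27, 28, 48, 49, 50],
   [16, 17, 18, 19, 20, 21, 22, 23, 16, 24, 17, 18, 25, 26, 27, 28, 48, 49],
   [16, 17, 18, 19, 20, 21, 22, 23, 16, 24, 17, 18, 25, 26, 27, 28, 48, 49, 50],
   [16, 17, 18, 19, 20, 21, 22, 23, 16, 24, 17, 18, 25, 19, 20, 26, 27, 28, 48, 49],
   [16, 17, 18, 19, 20, 21, 22, 23, 16, 24, 17, 18, 25, 19, 20, 26, 27, 28, 48, 49, 50],
   [16, 17, 18, 19, 20, 21, 22, 23, 16, 24, 17, 18, 25, 19, 20, 26, 21, 22, 27, 28, 48, 46],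
   [16, 17, 18, 19, 20, 21, 22, 23, 16, 24, 17, 18, 25, 19, 20, 26, 21, 22, 27, 28, 48, 46,
    49],
   [16, 17, 18, 19, 20, 21, 22, 23, 16, 24, 17, 18, 25, 19, 20, 26, 16, 21, 22, 23, 27, 24,
    28, 46],
   [16, 17, 18, 19, 20, 21, 22, 23, 16, 24, 17, 18, 25, 19, 20, 26, 16, 21, 22, 23, 27, 24,
    28, 46, 47],
   [16, 17, 18, 19, 20, 21, 22, 23, 16, 24, 17, 18, 25, 19, 20, 26, 16, 21, 22, 23, 27, 24,
    28, 46, 47, 25]]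

theorem isPackingCycle_of_mem_packingTails :
    ∀ t ∈ packingTails, IsPackingCycle (packingPrefix ++ t) := by
  decide +kernel

theorem exists_packingTails_length :
    ∀ m < 26, ∃ t ∈ packingTails, t.length = m + 1 := by
  decide +kernel

theorem exists_isPackingCycle_packingPrefix (m : ℕ) :
    ∃ t : List ℕ, t.length = m + 1 ∧ IsPackingCycle (packingPrefix ++ t) := by
  induction m using Nat.strong_induction_on with
  | _ m ih =>
    rcases lt_or_ge m 26 with hm | hm
    · obtain ⟨t, ht, hlen⟩ := exists_packingTails_length m hm
      exact ⟨t, hlen, isPackingCycle_of_mem_packingTails t ht⟩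
    · obtain ⟨t, hlen, ht⟩ := ih (m - 26) (by lia)
      obtain ⟨x, hx, hxlen⟩ := exists_packingTails_length 0 (by lia)
      have hp : packingPrefix.length = 25 := rfl
      refine ⟨x ++ (packingPrefix ++ t), ?_, ?_⟩
      · simp only [List.length_append]
        lia
      · exact (isPackingCycle_of_mem_packingTails x hx).splice hp.ge
          (List.length_pos_iff.1 (by lia)) (List.length_pos_iff.1 (by lia)) ht

/-- A word all of whose prefixes are packing cycles. -/
def shortPackingWord : List ℕ :=
  [22, 23, 24, 25, 26, 27, 28, 16, 17, 18, 19, 20, 21, 46, 47, 48, 49, 50, 51,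
    16, 17, 18, 19, 20, 21]

theorem isPackingCycle_take_shortPackingWord :
    ∀ s < 26, IsPackingCycle (shortPackingWord.take s) := by
  decide +kernel

theorem exists_isPackingCycle (s : ℕ) : ∃ l : List ℕ, l.length = s ∧ IsPackingCycle l := by
  rcases lt_or_ge s 26 with hs | hs
  · refine ⟨_, ?_, isPackingCycle_take_shortPackingWord s hs⟩
    have : shortPackingWord.length = 25 := rfl
    rw [List.length_take]
    lia
  · obtain ⟨t, hlen, ht⟩ := exists_isPackingCycle_packingPrefix (s - 26)
    refine ⟨_, ?_, ht⟩
    have : packingPrefix.length = 25 := rfl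
    rw [List.length_append]
    lia

/-- If `w 0, …, w (s−1)` are vertices of a graph `G` such that
`d_G(w j, w j') ≥ 2·(cyclic distance between j and j') + 1` for all `j ≠ j'`, then these
vertices can be packing-coloured with colours from `{16, …, 28} ∪ {46, …, 51}`. -/
theorem packing_colouring_with_colours_16_28_and_46_51 {V : Type*} (G : SimpleGraph V)
    (s : ℕ) (hs : 0 < s) (w : Fin s → V)
    (hd : ∀ j j' : Fin s, j ≠ j' →
      2 * cyclicDist s j.val j'.val + 1 ≤ G.dist (w j) (w j')) :
    ∃ c : Fin s → ℕ,
      (∀ j : Fin s, c j ∈ Finset.Icc 16 28 ∪ Finset.Icc 46 51) ∧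
      (∀ j j' : Fin s, j ≠ j' → c j = c j' → c j < G.dist (w j) (w j')) := by
  obtain ⟨l, rfl, hmem, hl⟩ := exists_isPackingCycle s
  refine ⟨fun j => l.getD j 0, fun j => ?_, fun j j' hne heq => ?_⟩
  · dsimp only
    rw [List.getD_eq_getElem _ _ j.isLt]
    exact hmem _ (List.getElem_mem _)
  · have hdist := hd j j' hne
    have hj := j.isLt
    have hj' := j'.isLt
    dsimp only at heq ⊢
    unfold cyclicDist at hdist
    rcases lt_or_gt_of_ne (Fin.val_ne_of_ne hne) with h | h
    · have := hl j' hj' j h heq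
      lia
    · have := hl j hj j' h heq.symm
      lia
end

section
/- Every cycle has packing chromatic number at most 4: for every integer n > 2 there exists a packing colouring of the cycle C_n using only colours in {1, 2, 3, 4}, i.e. a function c : ZMod n → {1,2,3,4} such that any two distinct vertices u, v with c(u) = c(v) are at graph distance greater than c(u) in C_n. -/
/-- Every cycle has packing chromatic number at most 4: for every `n > 2` the cycle `C_n`
admits a packing colouring using only colours in `{1, 2, 3, 4}`. -/
theorem packing_chromatic_number_cycle_le_four (n : ℕ) (hn : 2 < n) :
    ∃ c : ZMod n → ℕ,
      (∀ v : ZMod n, c v ∈ Finset.Icc 1 4) ∧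
      (∀ u v : ZMod n, u ≠ v → c u = c v → c u < cycleDist n u v) := by
  have : NeZero n := ⟨by omega⟩
  refine ⟨fun v => if v.val + 1 = n ∧ n % 4 ≠ 0 then 4 else if v.val % 2 = 0 then 1
    else if v.val % 4 = 1 then 2 else 3, fun v => ?_, fun u v huv => ?_⟩
  · rw [Finset.mem_Icc]
    dsimp only
    split_ifs <;> omega
  · have hu := ZMod.val_lt u
    have hv := ZMod.val_lt v
    have hne : u.val ≠ v.val := fun h => huv (ZMod.val_injective n h)
    unfold cycleDist
    dsimp only
    rw [lt_min_iff]
    generalize u.val = a at *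
    generalize v.val = b at *
    split_ifs <;> omega
end

section
/- For every positive integer k there is a packing colouring of the two-way infinite path with colours {k, k+1, ..., 3k+2}: there exists c : ℤ → ℕ with c(m) ∈ {k,...,3k+2} for all m, such that for all m ≠ n with c(m) = c(n) one has |m − n| > c(m). -/
/-- The sequence starting at `k` in which each term is obtained from the previous term `b`
by adding `⌈b / d⌉`. -/
def ceilGrowth (d k : ℕ) : ℕ → ℕ
  | 0 => k
  | i + 1 => ceilGrowth d k i + (ceilGrowth d k i + d - 1) / d

theorem ceilGrowth_le_mul_sub {d : ℕ} (hd : 0 < d) (k i : ℕ) :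
    ceilGrowth d k (i + 1) ≤ (d + 1) * (ceilGrowth d k (i + 1) - ceilGrowth d k i) := by
  have h := Nat.lt_mul_div_succ (ceilGrowth d k i + d - 1) hd
  simp only [ceilGrowth, Nat.add_sub_cancel_left]
  grind

theorem ceilGrowth_strictMono {d k : ℕ} (hd : 0 < d) (hk : 0 < k) :
    StrictMono (ceilGrowth d k) := by
  have pos : ∀ i, 0 < ceilGrowth d k i := by
    intro i
    induction i with
    | zero => exact hk
    | succ i ih => exact Nat.add_pos_left ih _
  refine strictMono_nat_of_lt_succ fun i => Nat.lt_add_of_pos_right (Nat.div_pos ?_ hd)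
  have := pos i
  omega

/-- If `b` is strictly increasing and `b (i + 1) ≤ m * (b (i + 1) - b i)` for every `i`, then the
two-way infinite path has a packing colouring with colours in `[b 0, b m)`: the `i`-th residue
class modulo `m` cycles through the colours in `[b i, b (i + 1))`. -/
theorem exists_packing_colouring_of_strictMono {m : ℕ} (hm : 0 < m) {b : ℕ → ℕ}
    (hb : StrictMono b) (hgap : ∀ i, b (i + 1) ≤ m * (b (i + 1) - b i)) :
    ∃ c : ℤ → ℕ, (∀ x, b 0 ≤ c x ∧ c x < b m) ∧
      ∀ x y : ℤ, x ≠ y → c x = c y → (c x : ℤ) < |x - y| := by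
  have hm' : (0 : ℤ) < m := by exact_mod_cast hm
  let r : ℤ → ℕ := fun x => (x % m).toNat
  let g : ℤ → ℕ := fun x => b (r x + 1) - b (r x)
  let s : ℤ → ℕ := fun x => (x / m % g x).toNat
  have hr (x : ℤ) : (r x : ℤ) = x % m := Int.toNat_of_nonneg (Int.emod_nonneg _ hm'.ne')
  have hrm (x : ℤ) : r x < m := by
    have := Int.emod_lt_of_pos x hm'
    rw [← hr] at this
    exact_mod_cast this
  have hg (x : ℤ) : 0 < g x := Nat.sub_pos_of_lt (hb (Nat.lt_succ_self _))
  have hg' (x : ℤ) : (0 : ℤ) < g x := by exact_mod_cast hg x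
  have hs (x : ℤ) : (s x : ℤ) = x / m % g x :=
    Int.toNat_of_nonneg (Int.emod_nonneg _ (hg' x).ne')
  have hsg (x : ℤ) : b (r x) + s x < b (r x + 1) := by
    have h := Int.emod_lt_of_pos (x / m) (hg' x)
    rw [← hs] at h
    have h' : s x < g x := by exact_mod_cast h
    exact Nat.add_lt_of_lt_sub' h'
  refine ⟨fun x => b (r x) + s x, fun x => ⟨?_, ?_⟩, fun x y hxy hc => ?_⟩
  · exact (hb.monotone (Nat.zero_le _)).trans (Nat.le_add_right _ _)
  · exact (hsg x).trans_le (hb.monotone (hrm x))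
  · simp only at hc ⊢
    have hrr : r x = r y := by
      have h₁ : r x < r y + 1 := hb.lt_iff_lt.1 (by have := hsg y; omega)
      have h₂ : r y < r x + 1 := hb.lt_iff_lt.1 (by have := hsg x; omega)
      omega
    have hss : s x = s y := by rw [hrr] at hc; omega
    have hgg : g x = g y := by simp only [g, hrr]
    have hmod : x % m = y % m := by rw [← hr, ← hr, hrr]
    have hdvd : (g x : ℤ) ∣ x / m - y / m := by
      apply Int.dvd_of_emod_eq_zero
      apply Int.emod_eq_emod_iff_emod_sub_eq_zero.1
      rw [← hs, hss, hs, hgg]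
    have hsub : x - y = m * (x / m - y / m) := by
      linarith [Int.emod_add_mul_ediv x m, Int.emod_add_mul_ediv y m]
    have hle : ((m * g x : ℕ) : ℤ) ≤ |x - y| := by
      push_cast
      refine Int.le_of_dvd (abs_pos.2 (sub_ne_zero.2 hxy)) ((dvd_abs _ _).2 ?_)
      rw [hsub]
      exact mul_dvd_mul_left _ hdvd
    refine lt_of_lt_of_le ?_ hle
    exact_mod_cast (hsg x).trans_le (hgap (r x))

theorem exists_ceilGrowth_le (k : ℕ) (hk : 0 < k) :
    ∃ d, 0 < d ∧ ceilGrowth d k (d + 1) ≤ 3 * k + 3 := by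
  by_cases h : k < 110
  · have small : ∀ k < 110, 0 < k → ∃ d < 9, 0 < d ∧ ceilGrowth d k (d + 1) ≤ 3 * k + 3 := by
      decide +kernel
    obtain ⟨d, -, hd⟩ := small k h hk
    exact ⟨d, hd⟩
  · refine ⟨8, by norm_num, ?_⟩
    have step (i : ℕ) : 8 * ceilGrowth 8 k (i + 1) ≤ 9 * ceilGrowth 8 k i + 7 := by
      simp only [ceilGrowth]
      omega
    have h₀ : ceilGrowth 8 k 0 = k := rfl
    linarith [step 0, step 1, step 2, step 3, step 4, step 5, step 6, step 7, step 8]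

/-- For every positive integer `k` there is a packing colouring of the two-way infinite
path (vertex set `ℤ`, distance `|m − n|`) with colours `{k, k+1, …, 3k+2}`. -/
theorem packing_colouring_Z_colours_k_to_3k_add_2 (k : ℕ) (hk : 0 < k) :
    ∃ c : ℤ → ℕ,
      (∀ m : ℤ, k ≤ c m ∧ c m ≤ 3 * k + 2) ∧
      (∀ m n : ℤ, m ≠ n → c m = c n → (c m : ℤ) < |m - n|) := by
  obtain ⟨d, hd, hle⟩ := exists_ceilGrowth_le k hk
  obtain ⟨c, hc, hpack⟩ := exists_packing_colouring_of_strictMono d.succ_pos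
    (ceilGrowth_strictMono hd hk) (ceilGrowth_le_mul_sub hd k)
  exact ⟨c, fun x => ⟨(hc x).1, Nat.le_of_lt_succ ((hc x).2.trans_le hle)⟩, hpack⟩
end

section
/- For every integer k ≥ 34 there is a packing colouring of the two-way infinite path with colours {k, k+1, ..., 3k−1}: there exists c : ℤ → ℕ with c(m) ∈ {k,...,3k−1} for all m, such that for all m ≠ n with c(m) = c(n) one has |m − n| > c(m). -/
/-- The first colour left over after the least colours `t, t + 1, …` that suffice
for a residue class modulo `m` have been used on it. -/
def nextColour (m t : ℕ) : ℕ := t + (t + (m - 2)) / (m - 1)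

/-- The first colour left over after colouring the residue classes in `L`, given as pairs
(residue, modulus), one after the other with consecutive colours starting at `t`. -/
def lastColour : List (ℕ × ℕ) → ℕ → ℕ
  | [], t => t
  | p :: L, t => lastColour L (nextColour p.2 t)

lemma le_lastColour (L : List (ℕ × ℕ)) (t : ℕ) : t ≤ lastColour L t := by
  induction L generalizing t with
  | nil => exact le_rfl
  | cons p L ih => exact (Nat.le_add_right _ _).trans (ih _)

/-- Round-robin colouring of a single residue class. -/
lemma exists_packingColouring_residueClass (r m t : ℕ) (hm : 2 ≤ m) (ht : 0 < t) :
    ∃ c : ℤ → ℕ, (∀ x, t ≤ c x ∧ c x < nextColour m t) ∧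
      ∀ x y : ℤ, x % m = r → y % m = r → x ≠ y → c x = c y → (c x : ℤ) < |x - y| := by
  obtain ⟨d, rfl⟩ : ∃ d, m = d + 2 := ⟨m - 2, by omega⟩
  set j := (t + d) / (d + 1) with hj
  have hj_pos : 0 < j := Nat.div_pos (by omega) (by omega)
  have hjt : t ≤ (d + 1) * j := by
    have h₁ := Nat.div_add_mod (t + d) (d + 1)
    have h₂ := Nat.mod_lt (t + d) (Nat.add_one_pos d)
    rw [← hj] at h₁
    omega
  have hnext : nextColour (d + 2) t = t + j := rfl
  have hj_pos' : (0 : ℤ) < j := by exact_mod_cast hj_pos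
  have hlt (x : ℤ) : (x / (d + 2 : ℕ) % j).toNat < j := by
    have h₁ := Int.emod_nonneg (x / (d + 2 : ℕ)) hj_pos'.ne'
    have h₂ := Int.emod_lt_of_pos (x / (d + 2 : ℕ)) hj_pos'
    omega
  refine ⟨fun x ↦ t + (x / (d + 2 : ℕ) % j).toNat, fun x ↦ ?_, fun x y hx hy hxy h ↦ ?_⟩
  · have := hlt x
    dsimp only
    omega
  · have h₁ := Int.emod_nonneg (x / (d + 2 : ℕ)) hj_pos'.ne'
    have h₂ := Int.emod_nonneg (y / (d + 2 : ℕ)) hj_pos'.ne'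
    have h₃ : x / (d + 2 : ℕ) % j = y / (d + 2 : ℕ) % j := by
      dsimp only at h
      omega
    obtain ⟨q, hq⟩ := Int.ModEq.dvd h₃.symm
    have hdiff : x - y = ((d + 2 : ℕ) : ℤ) * j * q := by
      have hx' := Int.mul_ediv_add_emod x (d + 2 : ℕ)
      have hy' := Int.mul_ediv_add_emod y (d + 2 : ℕ)
      rw [hx] at hx'
      rw [hy] at hy'
      linear_combination hy' - hx' + ((d + 2 : ℕ) : ℤ) * hq
    have hq0 : q ≠ 0 := by
      rintro rfl
      exact hxy (by linarith)
    have hdist : ((d + 2 : ℕ) : ℤ) * j ≤ |x - y| := by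
      rw [hdiff, abs_mul, abs_of_nonneg (by positivity)]
      exact le_mul_of_one_le_right (by positivity) (Int.one_le_abs hq0)
    have := hlt x
    have hcol : t + (x / (d + 2 : ℕ) % j).toNat < (d + 2) * j := by linarith
    exact lt_of_lt_of_le (by exact_mod_cast hcol) hdist

/-- The residue classes in `L` can be coloured one after the other. -/
lemma exists_packingColouring_residueClasses (L : List (ℕ × ℕ)) (hL : ∀ p ∈ L, 2 ≤ p.2)
    (t : ℕ) (ht : 0 < t) :
    ∃ c : ℤ → ℕ, ∀ x : ℤ, (∃ p ∈ L, x % (p.2 : ℤ) = p.1) →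
      (t ≤ c x ∧ c x < lastColour L t) ∧
      ∀ y : ℤ, (∃ p ∈ L, y % (p.2 : ℤ) = p.1) → x ≠ y → c x = c y → (c x : ℤ) < |x - y| := by
  induction L generalizing t with
  | nil => exact ⟨fun _ ↦ 0, by simp⟩
  | cons p L ih =>
    have hnext : t ≤ nextColour p.2 t := Nat.le_add_right _ _
    obtain ⟨c, hc⟩ := ih (fun q hq ↦ hL q (List.mem_cons_of_mem _ hq)) _ (ht.trans_le hnext)
    obtain ⟨e, he, he'⟩ := exists_packingColouring_residueClass p.1 p.2 t (hL p (by simp)) ht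
    have hlast := le_lastColour L (nextColour p.2 t)
    refine ⟨fun x ↦ if x % (p.2 : ℤ) = p.1 then e x else c x, fun x hx ↦ ?_⟩
    simp only [List.exists_mem_cons_iff, lastColour] at hx ⊢
    have hex := he x
    by_cases hxp : x % (p.2 : ℤ) = p.1
    · simp only [hxp, if_true]
      refine ⟨⟨hex.1, hex.2.trans_le hlast⟩, fun y hy hxy h ↦ ?_⟩
      by_cases hyp : y % (p.2 : ℤ) = p.1
      · exact he' x y hxp hyp hxy (by simpa [hyp] using h)
      · have := (hc y (hy.resolve_left hyp)).1
        simp only [hyp, if_false] at h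
        omega
    · obtain ⟨hcx, hcx'⟩ := hc x (hx.resolve_left hxp)
      simp only [hxp, if_false]
      refine ⟨⟨hnext.trans hcx.1, hcx.2⟩, fun y hy hxy h ↦ ?_⟩
      by_cases hyp : y % (p.2 : ℤ) = p.1
      · have := he y
        simp only [hyp, if_true] at h
        omega
      · exact hcx' y (hy.resolve_left hyp) hxy (by simpa [hyp] using h)

/-- A list of residue classes covering `ℤ` yields a packing colouring of `ℤ`. -/
lemma exists_packingColouring_of_cover {k N : ℕ} (L : List (ℕ × ℕ))
    (hk : 0 < k ∧ 0 < N) (hL : ∀ p ∈ L, 2 ≤ p.2 ∧ p.2 ∣ N)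
    (hcover : ∀ x < N, ∃ p ∈ L, x % p.2 = p.1) (hlast : lastColour L k ≤ 3 * k) :
    ∃ c : ℤ → ℕ, (∀ m : ℤ, k ≤ c m ∧ c m ≤ 3 * k - 1) ∧
      (∀ m n : ℤ, m ≠ n → c m = c n → (c m : ℤ) < |m - n|) := by
  have hmem (x : ℤ) : ∃ p ∈ L, x % (p.2 : ℤ) = p.1 := by
    have hN : (0 : ℤ) < N := by exact_mod_cast hk.2
    have h₁ := Int.emod_nonneg x hN.ne'
    have h₂ := Int.emod_lt_of_pos x hN
    obtain ⟨p, hp, h⟩ := hcover (x % N).toNat (by omega)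
    refine ⟨p, hp, ?_⟩
    rw [← Int.emod_emod_of_dvd x (Int.natCast_dvd_natCast.2 (hL p hp).2), ← h, Int.natCast_mod,
      Int.toNat_of_nonneg h₁]
  obtain ⟨c, hc⟩ := exists_packingColouring_residueClasses L (fun p hp ↦ (hL p hp).1) k hk.1
  refine ⟨c, fun m ↦ ?_, fun m n ↦ (hc m (hmem m)).2 n (hmem n)⟩
  have := (hc m (hmem m)).1
  omega

/-- The list of all residue classes modulo `M`. -/
def allResidues (M : ℕ) : List (ℕ × ℕ) := (List.range M).map fun r ↦ (r, M)

lemma exists_packingColouring_of_allResidues {k M : ℕ} (hk : 0 < k) (hM : 2 ≤ M)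
    (hlast : lastColour (allResidues M) k ≤ 3 * k) :
    ∃ c : ℤ → ℕ, (∀ m : ℤ, k ≤ c m ∧ c m ≤ 3 * k - 1) ∧
      (∀ m n : ℤ, m ≠ n → c m = c n → (c m : ℤ) < |m - n|) := by
  refine exists_packingColouring_of_cover (N := M) (allResidues M) ⟨hk, by omega⟩ ?_ ?_ hlast
  · simp [allResidues, hM]
  · intro x hx
    exact ⟨(x, M), by simpa [allResidues] using hx, Nat.mod_eq_of_lt hx⟩

lemma lastColour_allResidues_twelve {k : ℕ} (hk : 128 ≤ k) :
    lastColour (allResidues 12) k ≤ 3 * k := by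
  have hnext (t : ℕ) : 11 * nextColour 12 t ≤ 12 * t + 10 := by
    simp only [nextColour]
    omega
  have hlist : allResidues 12 = [(0, 12), (1, 12), (2, 12), (3, 12), (4, 12), (5, 12), (6, 12),
    (7, 12), (8, 12), (9, 12), (10, 12), (11, 12)] := by decide
  simp only [hlist, lastColour]
  set f := nextColour 12
  have h₁ := hnext k
  have h₂ := hnext (f k)
  have h₃ := hnext (f (f k))
  have h₄ := hnext (f (f (f k)))
  have h₅ := hnext (f (f (f (f k))))
  have h₆ := hnext (f (f (f (f (f k)))))
  have h₇ := hnext (f (f (f (f (f (f k))))))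
  have h₈ := hnext (f (f (f (f (f (f (f k)))))))
  have h₉ := hnext (f (f (f (f (f (f (f (f k))))))))
  have h₁₀ := hnext (f (f (f (f (f (f (f (f (f k)))))))))
  have h₁₁ := hnext (f (f (f (f (f (f (f (f (f (f k))))))))))
  have h₁₂ := hnext (f (f (f (f (f (f (f (f (f (f (f k)))))))))))
  linarith

set_option maxRecDepth 20000 in
lemma exists_lastColour_allResidues_le :
    ∀ k < 128, 34 ≤ k → k ∉ [34, 37, 38, 39, 43] →
      ∃ M < 40, 2 ≤ M ∧ lastColour (allResidues M) k ≤ 3 * k := by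
  decide

/-- For every integer `k ≥ 34` there is a packing colouring of the two-way infinite path
(vertex set `ℤ`, distance `|m − n|`) with colours `{k, k+1, …, 3k−1}`. -/
theorem packing_colouring_Z_colours_k_to_3k_sub_1 (k : ℕ) (hk : 34 ≤ k) :
    ∃ c : ℤ → ℕ,
      (∀ m : ℤ, k ≤ c m ∧ c m ≤ 3 * k - 1) ∧
      (∀ m n : ℤ, m ≠ n → c m = c n → (c m : ℤ) < |m - n|) := by
  by_cases hk' : 128 ≤ k
  · exact exists_packingColouring_of_allResidues (by omega) (by norm_num)
      (lastColour_allResidues_twelve hk')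
  by_cases hmem : k ∉ [34, 37, 38, 39, 43]
  · obtain ⟨M, -, hM, hlast⟩ := exists_lastColour_allResidues_le k (by omega) hk hmem
    exact exists_packingColouring_of_allResidues (by omega) hM hlast
  simp only [List.mem_cons, List.not_mem_nil, or_false, not_not] at hmem
  obtain rfl | rfl | rfl | rfl | rfl := hmem
  · exact exists_packingColouring_of_cover (N := 36)
      [(0, 9), (3, 9), (2, 12), (6, 9), (5, 12), (8, 12), (11, 12), (1, 9), (4, 9), (7, 9)]
      (by decide) (by decide) (by decide) (by decide)
  · exact exists_packingColouring_of_cover (N := 48)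
      [(2, 16), (6, 16), (1, 12), (0, 8), (5, 12), (10, 16), (4, 8), (14, 16),
        (9, 12), (3, 16), (7, 16), (11, 16), (15, 16)]
      (by decide) (by decide) (by decide) (by decide)
  · exact exists_packingColouring_of_cover (N := 36)
      [(0, 9), (1, 12), (3, 9), (4, 12), (7, 12), (10, 12), (2, 12), (5, 12), (8, 12),
        (11, 12), (6, 9)]
      (by decide) (by decide) (by decide) (by decide)
  · exact exists_packingColouring_of_cover (N := 36)
      [(0, 9), (1, 12), (3, 9), (4, 12), (7, 12), (10, 12), (2, 12), (6, 9), (5, 12),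
        (8, 12), (11, 12)]
      (by decide) (by decide) (by decide) (by decide)
  · exact exists_packingColouring_of_cover (N := 36)
      [(1, 12), (0, 9), (4, 12), (7, 12), (10, 12), (2, 12), (5, 12), (8, 12),
        (3, 9), (6, 9), (11, 12)]
      (by decide) (by decide) (by decide) (by decide)
end

section
/- Every subcubic tree is packing 7-colourable: if T is a finite tree (a connected acyclic simple graph) in which every vertex has degree at most 3, then there exists a packing colouring of T using only colours in {1, 2, 3, 4, 5, 6, 7}, i.e. a function c : V(T) → {1,...,7} such that any two distinct vertices u, v with c(u) = c(v) satisfy d_T(u,v) > c(u). -/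
/-!
# Packing colourings of subcubic trees

A finite top-down automaton on binary words colours the nodes of the infinite binary tree. Every
state `s` carries, for each colour `c`, a threshold `t = threshold s c`: nodes of colour `c` outside
the subtree rooted at a node in state `s` may lie at distance `t` or more from that node, while
those inside are at distance at least `c + 1 - t`. These bounds are checked locally, and together
they show that the colouring is a packing colouring. A subcubic tree, rooted at a vertex with at
most two neighbours, embeds into the binary tree.
-/

namespace SubcubicTree

/-- The colour of each state of the automaton. -/
def stateColour : Fin 32 → Fin 8 :=
  ![1, 7, 2, 3, 6, 1, 1, 1, 1, 1, 1, 1, 2, 3, 4, 5,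
    2, 3, 2, 3, 1, 1, 1, 1, 1, 1, 2, 3, 2, 3, 1, 1]

/-- The states of the two children of a node. -/
def childStates : Fin 32 → Fin 32 × Fin 32 :=
  ![(2, 3), (0, 0), (7, 9), (6, 8), (5, 5), (12, 13), (14, 18), (14, 19),
    (15, 16), (15, 17), (4, 12), (4, 13), (21, 23), (20, 22), (25, 25), (24, 24),
    (11, 21), (10, 20), (11, 23), (10, 22), (14, 28), (14, 29), (15, 26), (15, 27),
    (16, 27), (18, 29), (7, 31), (6, 30), (9, 31), (8, 30), (1, 2), (1, 3)]

/-- The threshold separating the nodes of a given colour inside and outside a subtree. -/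
def threshold : Fin 32 → Fin 8 → ℕ :=
  ![![0, 2, 2, 3, 2, 3, 2, 1], ![0, 1, 1, 2, 1, 2, 1, 8],
    ![0, 1, 3, 2, 3, 4, 3, 2], ![0, 1, 1, 4, 3, 4, 3, 2],
    ![0, 1, 1, 2, 1, 2, 7, 2], ![0, 2, 2, 3, 2, 3, 1, 3],
    ![0, 2, 2, 1, 4, 3, 4, 3], ![0, 2, 1, 3, 4, 3, 4, 3],
    ![0, 2, 2, 1, 2, 5, 4, 3], ![0, 2, 1, 3, 2, 5, 4, 3],
    ![0, 2, 2, 1, 2, 3, 6, 3], ![0, 2, 1, 3, 2, 3, 6, 3],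
    ![0, 1, 3, 2, 3, 4, 1, 4], ![0, 1, 1, 4, 3, 4, 1, 4],
    ![0, 1, 1, 2, 5, 2, 3, 4], ![0, 1, 1, 2, 1, 6, 3, 4],
    ![0, 1, 3, 2, 3, 2, 5, 4], ![0, 1, 1, 4, 3, 2, 5, 4],
    ![0, 1, 3, 2, 1, 4, 5, 4], ![0, 1, 1, 4, 1, 4, 5, 4],
    ![0, 2, 2, 1, 4, 3, 2, 5], ![0, 2, 1, 3, 4, 3, 2, 5],
    ![0, 2, 2, 1, 2, 5, 2, 5], ![0, 2, 1, 3, 2, 5, 2, 5],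
    ![0, 2, 2, 3, 2, 1, 4, 5], ![0, 2, 2, 3, 1, 3, 4, 5],
    ![0, 1, 3, 2, 3, 2, 3, 6], ![0, 1, 1, 4, 3, 2, 3, 6],
    ![0, 1, 3, 2, 1, 4, 3, 6], ![0, 1, 1, 4, 1, 4, 3, 6],
    ![0, 2, 2, 1, 2, 3, 2, 7], ![0, 2, 1, 3, 2, 3, 2, 7]]

/-- The state of the child of a node in state `s` in the direction `b`. -/
def childState (s : Fin 32) (b : Bool) : Fin 32 :=
  if b then (childStates s).2 else (childStates s).1

/-- The state of a node of the infinite binary tree. Nodes are words whose head is the last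
direction taken. -/
def nodeState : List Bool → Fin 32
  | [] => 0
  | b :: l => childState (nodeState l) b

/-- The colour of a node of the infinite binary tree. -/
def nodeColour (l : List Bool) : Fin 8 := stateColour (nodeState l)

lemma stateColour_pos (s : Fin 32) : 1 ≤ (stateColour s : ℕ) := by
  revert s; decide +kernel

lemma threshold_stateColour (s : Fin 32) :
    threshold s (stateColour s) = stateColour s + 1 := by
  revert s; decide +kernel

lemma threshold_childState_le (s : Fin 32) (b : Bool) (c : Fin 8) :
    threshold (childState s b) c ≤ threshold s c + 1 := by
  revert s b c; decide +kernel

lemma threshold_childState_stateColour_le (s : Fin 32) (b : Bool) :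
    threshold (childState s b) (stateColour s) ≤ 1 := by
  revert s b; decide +kernel

lemma threshold_childState_add_le (s : Fin 32) (c : Fin 8) :
    threshold (childState s false) c + threshold (childState s true) c ≤ c + 3 := by
  revert s c; decide +kernel

/-- A node of colour `c` inside a subtree has depth at least `c + 1` minus the threshold. -/
lemma nodeColour_append_lt (p q : List Bool) :
    (nodeColour (p ++ q) : ℕ) < threshold (nodeState q) (nodeColour (p ++ q)) + p.length := by
  induction p using List.reverseRecOn generalizing q with
  | nil => simp [nodeColour, threshold_stateColour]
  | append_singleton p a ih =>
    have h := ih (a :: q)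
    have h' := threshold_childState_le (nodeState q) a (nodeColour (p ++ a :: q))
    simp only [List.append_assoc, List.singleton_append, List.length_append, List.length_singleton]
    change _ < threshold (childState (nodeState q) a) _ + _ at h
    omega

lemma nodeColour_lt_of_descendant (p q : List Bool) (a : Bool)
    (h : nodeColour q = nodeColour (p ++ a :: q)) : (nodeColour q : ℕ) < p.length + 1 := by
  have h₁ := nodeColour_append_lt p (a :: q)
  have h₂ := threshold_childState_stateColour_le (nodeState q) a
  rw [← h] at h₁
  change _ < threshold (childState (nodeState q) a) (stateColour (nodeState q)) + _ at h₁
  omega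

lemma nodeColour_lt_of_branch (p p' q : List Bool)
    (h : nodeColour (p ++ false :: q) = nodeColour (p' ++ true :: q)) :
    (nodeColour (p ++ false :: q) : ℕ) < p.length + p'.length + 2 := by
  have h₁ := nodeColour_append_lt p (false :: q)
  have h₂ := nodeColour_append_lt p' (true :: q)
  have h₃ := threshold_childState_add_le (nodeState q) (nodeColour (p ++ false :: q))
  rw [← h] at h₂
  change _ < threshold (childState (nodeState q) false) _ + _ at h₁
  change _ < threshold (childState (nodeState q) true) _ + _ at h₂
  omega

/-- A path through a common ancestor of two distinct nodes of the same colour `c` has length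
greater than `c`. -/
lemma nodeColour_lt_of_ne (p p' q : List Bool) (hne : p ≠ p')
    (h : nodeColour (p ++ q) = nodeColour (p' ++ q)) :
    (nodeColour (p ++ q) : ℕ) < p.length + p'.length := by
  induction p using List.reverseRecOn generalizing p' q with
  | nil =>
    cases p' using List.reverseRecOn with
    | nil => exact absurd rfl hne
    | append_singleton p' b =>
      simpa using nodeColour_lt_of_descendant p' q b (by simpa using h)
  | append_singleton p a ih =>
    cases p' using List.reverseRecOn with
    | nil =>
      rw [h]
      simpa using nodeColour_lt_of_descendant p q a (by simpa using h.symm)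
    | append_singleton p' b =>
      simp only [List.append_assoc, List.singleton_append, List.length_append,
        List.length_singleton] at h ⊢
      by_cases hab : a = b
      · subst hab
        have := ih p' (a :: q) (by rintro rfl; exact hne rfl) h
        omega
      · cases a <;> cases b <;> first | exact absurd rfl hab | skip
        · have := nodeColour_lt_of_branch p p' q h
          omega
        · have := nodeColour_lt_of_branch p' p q h.symm
          rw [h]
          omega

/-- Along a map to binary words sending adjacent vertices to parent and child, a walk yields a path
through a common ancestor that is no longer than the walk. -/
lemma exists_common_suffix {V : Type*} {G : SimpleGraph V} {f : V → List Bool}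
    (hf : ∀ u v, G.Adj u v → (∃ b, f u = b :: f v) ∨ ∃ b, f v = b :: f u)
    {u v : V} (w : G.Walk u v) :
    ∃ p p' q, f u = p ++ q ∧ f v = p' ++ q ∧ p.length + p'.length ≤ w.length := by
  induction w with
  | nil => exact ⟨[], [], _, rfl, rfl, le_rfl⟩
  | cons hadj w ih =>
    obtain ⟨p, p', q, hp, hp', hlen⟩ := ih
    rw [SimpleGraph.Walk.length_cons]
    rcases hf _ _ hadj with ⟨b, hb⟩ | ⟨b, hb⟩
    · exact ⟨b :: p, p', q, by simp [hb, hp], hp', by simp only [List.length_cons]; omega⟩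
    · cases p with
      | nil =>
        refine ⟨[], p' ++ [b], _, rfl, ?_, ?_⟩
        · rw [hp', ← List.nil_append q, ← hp, hb]; simp
        · simp at hlen ⊢; omega
      | cons a p =>
        rw [hb, List.cons_append, List.cons.injEq] at hp
        exact ⟨p, p', q, hp.2, hp', by simp only [List.length_cons] at hlen; omega⟩

lemma exists_injOn_bool {V : Type*} (s : Finset V) (hs : s.card ≤ 2) :
    ∃ f : V → Bool, Set.InjOn f s := by
  classical
  rcases s.eq_empty_or_nonempty with rfl | ⟨a, ha⟩
  · exact ⟨fun _ => true, by simp⟩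
  · refine ⟨fun x => decide (x = a), fun x hx y hy hxy => ?_⟩
    by_contra hne
    have hxy : x = a ↔ y = a := by simpa using hxy
    have hxa : x ≠ a := fun h => hne (h.trans (hxy.1 h).symm)
    have hya : y ≠ a := fun h => hxa (hxy.2 h)
    have hsub : {a, x, y} ⊆ s := by
      simp only [Finset.insert_subset_iff, Finset.singleton_subset_iff]
      exact ⟨ha, hx, hy⟩
    have := Finset.card_le_card hsub
    rw [Finset.card_eq_three.2 ⟨a, x, y, hxa.symm, hya.symm, hne, rfl⟩] at this
    omega

/-- In a tree, a vertex has at most one neighbour closer to a given root. -/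
lemma eq_of_adj_of_dist_eq {V : Type*} {T : SimpleGraph V} (hT : T.IsTree) {r v w w' : V}
    (hw : T.Adj w v) (hw' : T.Adj w' v) (hd : T.dist r v = T.dist r w + 1)
    (hd' : T.dist r v = T.dist r w' + 1) : w = w' := by
  obtain ⟨p, hp⟩ := (hT.connected r w).exists_walk_length_eq_dist
  obtain ⟨p', hp'⟩ := (hT.connected r w').exists_walk_length_eq_dist
  have h₁ : (p.concat hw).IsPath := SimpleGraph.Walk.isPath_of_length_eq_dist _ (by simp [hp, hd])
  have h₂ : (p'.concat hw').IsPath :=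
    SimpleGraph.Walk.isPath_of_length_eq_dist _ (by simp [hp', hd'])
  have := (hT.existsUnique_path r v).unique h₁ h₂
  simpa using congrArg SimpleGraph.Walk.penultimate this

/-- In a tree, every vertex other than the root has a parent. -/
lemma exists_parent {V : Type*} {T : SimpleGraph V} (hT : T.IsTree) (r : V) :
    ∃ par : V → V, (∀ v, v ≠ r → T.Adj (par v) v ∧ T.dist r v = T.dist r (par v) + 1) ∧
      ∀ u v, T.Adj u v → T.dist r v = T.dist r u + 1 → par v = u := by
  have h : ∀ v, ∃ w, v ≠ r → T.Adj w v ∧ T.dist r v = T.dist r w + 1 := by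
    intro v
    by_cases hv : v = r
    · exact ⟨v, fun h => absurd hv h⟩
    · obtain ⟨p, hp⟩ := (hT.connected v r).exists_walk_length_eq_dist
      cases p with
      | nil => exact absurd rfl hv
      | @cons _ w _ hadj p =>
        refine ⟨w, fun _ => ⟨hadj.symm, ?_⟩⟩
        have h₁ := T.dist_le p
        have h₂ := hT.dist_eq_dist_add_one_of_adj r hadj
        rw [SimpleGraph.Walk.length_cons, T.dist_comm] at hp
        rw [T.dist_comm] at h₁
        omega
  choose par hpar using h
  refine ⟨par, hpar, fun u v hadj hd => ?_⟩
  have hv : v ≠ r := by rintro rfl; simp at hd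
  exact eq_of_adj_of_dist_eq hT (hpar v hv).1 hadj (hpar v hv).2 hd

/-- A subcubic tree with a vertex of degree at most 2 embeds into the infinite binary tree. -/
lemma exists_binary_embedding {V : Type*} [Fintype V] {T : SimpleGraph V} [DecidableRel T.Adj]
    (hT : T.IsTree) (hdeg : ∀ v, T.degree v ≤ 3) {r : V} (hr : T.degree r ≤ 2) :
    ∃ f : V → List Bool, Function.Injective f ∧
      ∀ u v, T.Adj u v → (∃ b, f u = b :: f v) ∨ ∃ b, f v = b :: f u := by
  classical
  obtain ⟨par, hpar, hpar'⟩ := exists_parent hT r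
  have hchild (p : V) : ({v | v ≠ r ∧ par v = p} : Finset V).card ≤ 2 := by
    by_cases hp : p = r
    · subst hp
      refine le_trans (Finset.card_le_card fun v hv => ?_) hr
      rw [Finset.mem_filter] at hv
      rw [SimpleGraph.mem_neighborFinset]
      simpa only [hv.2.2] using (hpar v hv.2.1).1
    · have hlt : ({v | v ≠ r ∧ par v = p} : Finset V) ⊂ T.neighborFinset p := by
        rw [Finset.ssubset_iff_of_subset fun v hv => ?_]
        · refine ⟨par p, by simpa using (hpar p hp).1.symm, fun hmem => ?_⟩
          rw [Finset.mem_filter] at hmem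
          have h₁ := (hpar p hp).2
          have h₂ := (hpar _ hmem.2.1).2
          rw [hmem.2.2] at h₂
          omega
        · rw [Finset.mem_filter] at hv
          rw [SimpleGraph.mem_neighborFinset]
          simpa only [hv.2.2] using (hpar v hv.2.1).1
      have := Finset.card_lt_card hlt
      rw [SimpleGraph.card_neighborFinset_eq_degree] at this
      have := hdeg p
      omega
  choose idx hidx using fun p => exists_injOn_bool _ (hchild p)
  let g : ℕ → V → List Bool :=
    fun n => n.rec (fun _ => []) fun _ g v => idx (par v) v :: g (par v)
  have hlen (n : ℕ) (v : V) : (g n v).length = n := by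
    induction n generalizing v with
    | zero => rfl
    | succ n ih => exact congrArg (· + 1) (ih (par v))
  have hinj (n : ℕ) (u v : V) (hu : T.dist r u = n) (hv : T.dist r v = n)
      (h : g n u = g n v) : u = v := by
    induction n generalizing u v with
    | zero =>
      exact (hT.connected.dist_eq_zero_iff.1 hu).symm.trans (hT.connected.dist_eq_zero_iff.1 hv)
    | succ n ih =>
      have hur : u ≠ r := by rintro rfl; simp at hu
      have hvr : v ≠ r := by rintro rfl; simp at hv
      have h₁ := (hpar u hur).2
      have h₂ := (hpar v hvr).2
      obtain ⟨hhead, htail⟩ := List.cons.inj h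
      have heq := ih _ _ (by omega) (by omega) htail
      rw [heq] at hhead
      exact hidx (par v) (by simp [hur, heq]) (by simp [hvr]) hhead
  have hstep (u v : V) (hadj : T.Adj u v) (hd : T.dist r v = T.dist r u + 1) :
      g (T.dist r v) v = idx u v :: g (T.dist r u) u := by
    rw [hd, ← hpar' u v hadj hd]
  refine ⟨fun v => g (T.dist r v) v, fun u v h => ?_, fun u v hadj => ?_⟩
  · have hd : T.dist r u = T.dist r v := by simpa [hlen] using congrArg List.length h
    exact hinj _ u v hd rfl (by simpa only [hd] using h)
  · rcases hT.dist_eq_dist_add_one_of_adj r hadj with hd | hd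
    · exact .inl ⟨_, hstep v u hadj.symm hd⟩
    · exact .inr ⟨_, hstep u v hadj hd⟩

lemma exists_degree_le_two {V : Type*} [Fintype V] {T : SimpleGraph V} [DecidableRel T.Adj]
    (hT : T.IsTree) : ∃ r, T.degree r ≤ 2 := by
  rcases subsingleton_or_nontrivial V with hV | hV
  · obtain ⟨r⟩ := hT.connected.nonempty
    exact ⟨r, by simp⟩
  · obtain ⟨r, hr⟩ := hT.exists_vert_degree_one_of_nontrivial
    exact ⟨r, by omega⟩

end SubcubicTree

/-- Every subcubic tree is packing 7-colourable: if `T` is a finite tree in which every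
vertex has degree at most 3, then there is a packing colouring of `T` using only colours
in `{1, …, 7}`. -/
theorem packing_colouring_subcubic_tree {V : Type*} [Fintype V]
    (T : SimpleGraph V) [DecidableRel T.Adj]
    (hT : T.IsTree) (hdeg : ∀ v : V, T.degree v ≤ 3) :
    ∃ c : V → ℕ,
      (∀ v : V, c v ∈ Finset.Icc 1 7) ∧
      (∀ u v : V, u ≠ v → c u = c v → c u < T.dist u v) := by
  obtain ⟨r, hr⟩ := SubcubicTree.exists_degree_le_two hT
  obtain ⟨f, hinj, hf⟩ := SubcubicTree.exists_binary_embedding hT hdeg hr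
  refine ⟨fun v => SubcubicTree.nodeColour (f v), fun v => ?_, fun u v hne h => ?_⟩
  · have := SubcubicTree.stateColour_pos (SubcubicTree.nodeState (f v))
    exact Finset.mem_Icc.2 ⟨this, Fin.is_le _⟩
  · obtain ⟨w, hw⟩ := (hT.connected u v).exists_walk_length_eq_dist
    obtain ⟨p, p', q, hp, hp', hlen⟩ := SubcubicTree.exists_common_suffix hf w
    have h := Fin.ext h
    rw [hp, hp'] at h
    have hpp : p ≠ p' := fun hpp => hne (hinj (by rw [hp, hp', hpp]))
    have := SubcubicTree.nodeColour_lt_of_ne p p' q hpp h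
    simp only [hp]
    omega
end

section
/- For every integer n ≥ 6, the Cartesian product P_n □ P_2 of the path on n vertices with the path on 2 vertices has packing chromatic number exactly 5: it admits a packing colouring with colours {1,2,3,4,5}, but admits no packing colouring with colours {1,2,3,4}. -/
namespace SimpleGraph

lemma natAbs_sub_le_length_of_pathGraph_walk {n : ℕ} {u v : Fin n}
    (w : (pathGraph n).Walk u v) : ((u : ℤ) - v).natAbs ≤ w.length := by
  induction w with
  | nil => simp
  | cons h _ ih =>
    rw [pathGraph_adj] at h
    rw [Walk.length_cons]
    omega

lemma pathGraph_exists_walk_length_eq {n : ℕ} (k : ℕ) (u v : Fin n) (h : (u : ℕ) + k = v) :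
    ∃ w : (pathGraph n).Walk u v, w.length = k := by
  induction k generalizing u with
  | zero =>
    obtain rfl : u = v := Fin.ext h
    exact ⟨.nil, rfl⟩
  | succ k ih =>
    obtain ⟨w, hw⟩ := ih ⟨u + 1, by omega⟩ (by simp only; omega)
    exact ⟨.cons (pathGraph_adj.2 (.inl rfl)) w, by rw [Walk.length_cons, hw]⟩

lemma dist_pathGraph {n : ℕ} (u v : Fin n) :
    (pathGraph n).dist u v = ((u : ℤ) - v).natAbs := by
  apply le_antisymm
  · wlog huv : (u : ℕ) ≤ v generalizing u v
    · rw [dist_comm, ← Int.natAbs_neg, neg_sub]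
      exact this v u (by omega)
    obtain ⟨w, hw⟩ := pathGraph_exists_walk_length_eq (v - u : ℕ) u v (by omega)
    have := dist_le w
    omega
  · obtain ⟨w, hw⟩ := (pathGraph_preconnected n u v).exists_walk_length_eq_dist
    exact hw ▸ natAbs_sub_le_length_of_pathGraph_walk w

lemma Preconnected.dist_boxProd {α β : Type*} {G : SimpleGraph α} {H : SimpleGraph β}
    (hG : G.Preconnected) (hH : H.Preconnected) (x y : α × β) :
    (G □ H).dist x y = G.dist x.1 y.1 + H.dist x.2 y.2 := by
  simp [dist, ENat.toNat_add (edist_ne_top_iff_reachable.2 (hG x.1 y.1))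
    (edist_ne_top_iff_reachable.2 (hH x.2 y.2))]

end SimpleGraph

/-- The `ℓ¹` distance on an `m × n` grid. -/
def gridDist {m n : ℕ} (u v : Fin m × Fin n) : ℕ :=
  ((u.1 : ℤ) - v.1).natAbs + ((u.2 : ℤ) - v.2).natAbs

lemma dist_pathGraph_boxProd_pathGraph {m n : ℕ} (u v : Fin m × Fin n) :
    ((SimpleGraph.pathGraph m).boxProd (SimpleGraph.pathGraph n)).dist u v = gridDist u v := by
  rw [(SimpleGraph.pathGraph_preconnected m).dist_boxProd (SimpleGraph.pathGraph_preconnected n),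
    SimpleGraph.dist_pathGraph, SimpleGraph.dist_pathGraph, gridDist]

/-- Backtracking search: can the partial colouring `l` be extended to the vertices in the given
list by colours `1, …, k` so that each new vertex is compatible, in the sense of packing colourings
for the distance `d`, with all the vertices coloured before it? -/
def packingExtends {V : Type*} [DecidableEq V] (d : V → V → ℕ) (k : ℕ) :
    List V → List (V × ℕ) → Bool
  | [], _ => true
  | v :: vs, l => (List.range' 1 k).any fun a =>
      l.all (fun p => decide (v = p.1 ∨ a ≠ p.2 ∨ a < d v p.1)) &&
        packingExtends d k vs ((v, a) :: l)

lemma packingExtends_of_packing {V : Type*} [DecidableEq V] {d : V → V → ℕ} {k : ℕ} {c : V → ℕ}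
    (hk : ∀ v, c v ∈ Finset.Icc 1 k) (hc : ∀ u v, u ≠ v → c u = c v → c u < d u v)
    (vs : List V) (l : List (V × ℕ)) (hl : ∀ p ∈ l, p.2 = c p.1) :
    packingExtends d k vs l = true := by
  induction vs generalizing l with
  | nil => rfl
  | cons v vs ih =>
    rw [packingExtends, List.any_eq_true]
    refine ⟨c v, ?_, ?_⟩
    · have := Finset.mem_Icc.1 (hk v)
      rw [List.mem_range'_1]
      omega
    · rw [Bool.and_eq_true, List.all_eq_true]
      refine ⟨fun p hp => decide_eq_true ?_, ih _ ?_⟩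
      · have := hc v p.1
        rw [hl p hp]
        tauto
      · simpa using hl

lemma not_packing_six_two_of_four (c : Fin 6 × Fin 2 → ℕ) (hk : ∀ v, c v ∈ Finset.Icc 1 4)
    (hc : ∀ u v, u ≠ v → c u = c v → c u < gridDist u v) : False := by
  have h := packingExtends_of_packing hk hc (List.finRange 6 ×ˢ List.finRange 2) [] (by simp)
  revert h
  decide +kernel

/-- A packing colouring of the two-row grid, periodic with period 6. -/
def ladderColouring (i j : ℕ) : ℕ :=
  if (i + j) % 2 = 0 then 1
  else if i % 3 = 0 then 2
  else if i % 3 = 1 then 3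
  else if i % 6 = 2 then 4
  else 5

lemma ladderColouring_mem_Icc (i j : ℕ) : ladderColouring i j ∈ Finset.Icc 1 5 := by
  unfold ladderColouring
  split_ifs <;> decide

lemma ladderColouring_lt_gridDist {n : ℕ} {u v : Fin n × Fin 2} (huv : u ≠ v)
    (h : ladderColouring u.1 u.2 = ladderColouring v.1 v.2) :
    ladderColouring u.1 u.2 < gridDist u v := by
  obtain ⟨⟨i, _⟩, ⟨j, _⟩⟩ := u
  obtain ⟨⟨i', _⟩, ⟨j', _⟩⟩ := v
  simp only [ne_eq, Prod.mk.injEq, Fin.mk.injEq] at huv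
  have hi : i % 6 = i % 3 ∨ i % 6 = i % 3 + 3 := by omega
  have hi' : i' % 6 = i' % 3 ∨ i' % 6 = i' % 3 + 3 := by omega
  simp only [ladderColouring, gridDist] at h ⊢
  split_ifs at h ⊢ <;> omega


/-- For every `n ≥ 6` the Cartesian product `P_n □ P_2` has packing chromatic number
exactly 5: it admits a packing colouring with colours `{1, …, 5}` but no packing
colouring with colours `{1, …, 4}`. -/
theorem packing_chromatic_number_path_box_P2 (n : ℕ) (hn : 6 ≤ n) :
    (∃ c : Fin n × Fin 2 → ℕ,
      (∀ v, c v ∈ Finset.Icc 1 5) ∧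
      (∀ u v, u ≠ v → c u = c v →
        c u < ((SimpleGraph.pathGraph n).boxProd (SimpleGraph.pathGraph 2)).dist u v)) ∧
    ¬ (∃ c : Fin n × Fin 2 → ℕ,
      (∀ v, c v ∈ Finset.Icc 1 4) ∧
      (∀ u v, u ≠ v → c u = c v →
        c u < ((SimpleGraph.pathGraph n).boxProd (SimpleGraph.pathGraph 2)).dist u v)) := by
  simp only [dist_pathGraph_boxProd_pathGraph]
  refine ⟨⟨fun v => ladderColouring v.1 v.2, fun v => ladderColouring_mem_Icc _ _,
    fun u v huv h => ladderColouring_lt_gridDist huv h⟩, ?_⟩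
  rintro ⟨c, hk, hc⟩
  refine not_packing_six_two_of_four (fun v => c (Fin.castLE hn v.1, v.2)) (fun v => hk _)
    fun u v huv h => hc _ _ (fun he => huv ?_) h
  simpa [Prod.ext_iff] using he
end
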